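/- Let λ : ℕ → ℝ satisfy λ_k ≥ 0 for all k, 0 ≤ λ₀ < 1, and Σ_{k=0}^∞ λ_k² = 1, and let β := max( λ₀², sup_{k≥1} λ_k²/2 ) ∈ (0,1). Fix d ≥ 1 and define, for 𝐤 ∈ ℤ^d, the function ψ_𝐤 : ℝ^d → ℝ by ψ_𝐤(x) = ∏_{j=1}^d ψ_{k_j}(x_j), where ψ₀(t) = λ₀, ψ_k(t) = λ_k cos(2πkt) and ψ_{−k}(t) = λ_k sin(2πkt) for k ≥ 1. For c ∈ ℓ₂(ℤ^d) let f_c(x) := Σ_{𝐤∈ℤ^d} c_𝐤 ψ_𝐤(x) (the series converges absolutely at every x). Let μ be the uniform probability measure on [0,1)^d. Then for every n ∈ ℕ, every family of continuous linear functionals L₁, …, L_n on ℓ₂(ℤ^d), and every map φ : ℝⁿ → (ℝ^d → ℝ), one has sup_{c ∈ ℓ₂(ℤ^d), ‖c‖₂ ≤ 1} esssup_μ |f_c − φ(L₁(c), …, L_n(c))| ≥ √( max(1 − n·β^d, 0) ). In particular, any deterministic method using n linear functionals with worst-case uniform error at most ε ∈ (0,1) must have n ≥ β^{−d}(1−ε)²,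 so the problem suffers from the curse of dimensionality in the deterministic setting. -/

import Mathlib

open MeasureTheory ProbabilityTheory
open scoped ENNReal NNReal

/-- The one-dimensional orthonormal system of the space `H_λ(𝕋)`:
`ψ₀ = λ₀`, `ψ_k = λ_k cos(2πk·)` and `ψ_{-k} = λ_k sin(2πk·)` for `k ≥ 1`. -/
noncomputable def psi1 (lam : ℕ → ℝ) (k : ℤ) (t : ℝ) : ℝ :=
  if k = 0 then lam 0
  else if 0 < k then lam k.toNat * Real.cos (2 * Real.pi * (k : ℝ) * t)
  else lam (-k).toNat * Real.sin (2 * Real.pi * ((-k : ℤ) : ℝ) * t)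

/-- Tensor-product basis functions `ψ_𝐤(x) = ∏_j ψ_{k_j}(x_j)` of `H_λ(𝕋^d)`. -/
noncomputable def psiProd (lam : ℕ → ℝ) {d : ℕ} (k : Fin d → ℤ) (x : Fin d → ℝ) : ℝ :=
  ∏ j, psi1 lam (k j) (x j)

/-- The uniform probability measure on `[0,1)^d`. -/
noncomputable def cubeMeasure (d : ℕ) : Measure (Fin d → ℝ) :=
  Measure.pi fun _ => volume.restrict (Set.Ico (0 : ℝ) 1)

open scoped InnerProductSpace

/-- The phase `θ_k` for which `ψ_k(t) = λ_{|k|} cos(2πkt + θ_k)`. -/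
noncomputable def trigPhase (k : ℤ) : ℝ := if k < 0 then Real.pi / 2 else 0

lemma psi1_eq_mul_cos (lam : ℕ → ℝ) (k : ℤ) (t : ℝ) :
    psi1 lam k t = lam k.natAbs * Real.cos (2 * Real.pi * k * t + trigPhase k) := by
  unfold psi1 trigPhase
  rcases lt_trichotomy k 0 with h | h | h
  · have h1 : (-k).toNat = k.natAbs := by omega
    rw [if_neg h.ne, if_neg (by omega), if_pos h, h1, Real.cos_add_pi_div_two, ← Real.sin_neg]
    congr 2
    push_cast
    ring
  · simp [h]
  · have h1 : k.toNat = k.natAbs := by omega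
    rw [if_neg h.ne', if_pos h, if_neg (by omega), h1, add_zero]

lemma continuous_psi1 (lam : ℕ → ℝ) (k : ℤ) : Continuous (psi1 lam k) := by
  have : psi1 lam k =
      fun t => lam k.natAbs * Real.cos (2 * Real.pi * k * t + trigPhase k) :=
    funext (psi1_eq_mul_cos lam k)
  rw [this]
  fun_prop

lemma continuous_psiProd (lam : ℕ → ℝ) {d : ℕ} (k : Fin d → ℤ) :
    Continuous (psiProd lam k) := by
  unfold psiProd
  exact continuous_finsetProd _ fun j _ => (continuous_psi1 lam (k j)).comp (continuous_apply j)

lemma hasSum_psi1_sq {lam : ℕ → ℝ} (h : HasSum (fun k => lam k ^ 2) 1) (t : ℝ) :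
    HasSum (fun k : ℤ => psi1 lam k t ^ 2) 1 := by
  set C : ℕ → ℝ := fun n => lam n ^ 2 * Real.cos (2 * Real.pi * n * t) ^ 2 with hC
  set S : ℕ → ℝ := fun n => lam n ^ 2 * Real.sin (2 * Real.pi * n * t) ^ 2 with hS
  have sC : Summable C := h.summable.of_nonneg_of_le (fun n => by positivity)
    fun n => mul_le_of_le_one_right (sq_nonneg _) (Real.cos_sq_le_one _)
  have sS : Summable S := h.summable.of_nonneg_of_le (fun n => by positivity)
    fun n => mul_le_of_le_one_right (sq_nonneg _) (Real.sin_sq_le_one _)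
  have hadd : (∑' n, C n) + ∑' n, S n = 1 := by
    refine (sC.hasSum.add sS.hasSum).unique ?_
    convert h using 2 with n
    simp only [hC, hS]
    linear_combination lam n ^ 2 * Real.cos_sq_add_sin_sq (2 * Real.pi * n * t)
  have hS' : HasSum (fun n => S (n + 1)) (∑' n, S n) := by
    have := (hasSum_nat_add_iff' 1).2 sS.hasSum
    simpa [hS] using this
  rw [← hadd]
  refine HasSum.of_nat_of_neg_add_one ?_ ?_
  · convert sC.hasSum using 2 with n
    have h1 : ¬ (n : ℤ) < 0 := by omega
    rw [psi1_eq_mul_cos, trigPhase, if_neg h1]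
    simp [hC, mul_pow]
  · convert hS' using 2 with n
    have h1 : (-((n : ℤ) + 1)).natAbs = n + 1 := by omega
    have h2 : -((n : ℤ) + 1) < 0 := by omega
    rw [psi1_eq_mul_cos, trigPhase, if_pos h2, h1, Real.cos_add_pi_div_two]
    simp only [hS]
    push_cast
    rw [show 2 * Real.pi * -((n : ℝ) + 1) * t = -(2 * Real.pi * (n + 1) * t) by ring, Real.sin_neg]
    ring

lemma hasSum_psiProd_sq {lam : ℕ → ℝ} (h : HasSum (fun k => lam k ^ 2) 1) :
    ∀ {d : ℕ} (x : Fin d → ℝ), HasSum (fun k : Fin d → ℤ => psiProd lam k x ^ 2) 1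
  | 0, x => by
    convert hasSum_unique (fun k : Fin 0 → ℤ => psiProd lam k x ^ 2)
    simp [psiProd]
  | d + 1, x => by
    have h1 := hasSum_psi1_sq h (x 0)
    have h2 := hasSum_psiProd_sq h (Fin.tail x)
    have h3 := h1.mul h2 (h1.summable.mul_of_nonneg h2.summable
      (fun _ => sq_nonneg _) fun _ => sq_nonneg _)
    rw [← (Fin.consEquiv fun _ => ℤ).hasSum_iff]
    rw [mul_one] at h3
    have h4 : (fun k : Fin (d + 1) → ℤ => psiProd lam k x ^ 2) ∘ (Fin.consEquiv fun _ => ℤ) =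
        fun p => psi1 lam p.1 (x 0) ^ 2 * psiProd lam p.2 (Fin.tail x) ^ 2 := by
      ext p
      simp [psiProd, Fin.consEquiv, Fin.prod_univ_succ, mul_pow, Fin.tail]
    rwa [h4]

lemma sq_psiProd_le_one {lam : ℕ → ℝ} (h : HasSum (fun k => lam k ^ 2) 1) {d : ℕ}
    (k : Fin d → ℤ) (x : Fin d → ℝ) : psiProd lam k x ^ 2 ≤ 1 :=
  le_hasSum (hasSum_psiProd_sq h x) k fun _ _ => sq_nonneg _

lemma integral_cos_int_mul_add (n : ℤ) (θ : ℝ) :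
    ∫ t in Set.Ico (0 : ℝ) 1, Real.cos (2 * Real.pi * n * t + θ) =
      if n = 0 then Real.cos θ else 0 := by
  rw [integral_Ico_eq_integral_Ioc, ← intervalIntegral.integral_of_le zero_le_one]
  split_ifs with hn
  · simp [hn]
  · have hc : 2 * Real.pi * (n : ℝ) ≠ 0 := by
      have : (n : ℝ) ≠ 0 := by exact_mod_cast hn
      positivity
    rw [intervalIntegral.integral_comp_mul_add (fun s => Real.cos s) hc θ, integral_cos]
    have : Real.sin (2 * Real.pi * n * 1 + θ) = Real.sin θ := by
      rw [← Real.sin_add_int_mul_two_pi θ n]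
      congr 1
      ring
    rw [this, mul_zero, zero_add, sub_self, smul_zero]

lemma integral_psi1_mul_psi1 (lam : ℕ → ℝ) (k m : ℤ) :
    ∫ t in Set.Ico (0 : ℝ) 1, psi1 lam k t * psi1 lam m t =
      if k = m then (if k = 0 then lam 0 ^ 2 else lam k.natAbs ^ 2 / 2) else 0 := by
  have key : ∀ t, psi1 lam k t * psi1 lam m t = lam k.natAbs * lam m.natAbs / 2 *
      (Real.cos (2 * Real.pi * (k - m : ℤ) * t + (trigPhase k - trigPhase m)) +
        Real.cos (2 * Real.pi * (k + m : ℤ) * t + (trigPhase k + trigPhase m))) := by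
    intro t
    rw [psi1_eq_mul_cos, psi1_eq_mul_cos]
    have h1 : 2 * Real.pi * (k - m : ℤ) * t + (trigPhase k - trigPhase m) =
      (2 * Real.pi * k * t + trigPhase k) - (2 * Real.pi * m * t + trigPhase m) := by
      push_cast; ring
    have h2 : 2 * Real.pi * (k + m : ℤ) * t + (trigPhase k + trigPhase m) =
      (2 * Real.pi * k * t + trigPhase k) + (2 * Real.pi * m * t + trigPhase m) := by
      push_cast; ring
    rw [h1, h2, Real.cos_sub, Real.cos_add (2 * Real.pi * k * t + trigPhase k)]
    ring
  have hint : ∀ (n : ℤ) (θ : ℝ), IntegrableOn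
      (fun t => Real.cos (2 * Real.pi * n * t + θ)) (Set.Ico (0 : ℝ) 1) := fun n θ =>
    (Continuous.integrableOn_Icc (by fun_prop)).mono_set Set.Ico_subset_Icc_self
  simp_rw [key]
  rw [integral_const_mul, integral_add (hint _ _) (hint _ _), integral_cos_int_mul_add,
    integral_cos_int_mul_add]
  by_cases hkm : k = m
  · subst hkm
    by_cases hk : k = 0
    · subst hk
      simp [trigPhase]
      ring
    · have : k + k ≠ 0 := by omega
      simp [hk, this]
      ring
  · rw [if_neg (by omega : ¬ k - m = 0), if_neg hkm]
    split_ifs with h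
    · have : trigPhase k + trigPhase m = Real.pi / 2 := by
        unfold trigPhase
        rcases lt_or_gt_of_ne (show k ≠ 0 by omega) with h0 | h0
        · rw [if_pos h0, if_neg (by omega), add_zero]
        · rw [if_neg (by omega), if_pos (by omega), zero_add]
      simp [this]
    · simp

lemma integral_psiProd_mul_psiProd (lam : ℕ → ℝ) {d : ℕ} (k m : Fin d → ℤ) :
    ∫ x, psiProd lam k x * psiProd lam m x ∂cubeMeasure d =
      if k = m then ∏ j, (if k j = 0 then lam 0 ^ 2 else lam (k j).natAbs ^ 2 / 2) else 0 := by
  unfold psiProd cubeMeasure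
  simp_rw [← Finset.prod_mul_distrib]
  rw [integral_fintype_prod_eq_prod (fun j t => psi1 lam (k j) t * psi1 lam (m j) t)]
  simp_rw [integral_psi1_mul_psi1]
  split_ifs with h
  · simp [h]
  · obtain ⟨j, hj⟩ := Function.ne_iff.1 h
    exact Finset.prod_eq_zero (Finset.mem_univ j) (if_neg hj)

instance isProbabilityMeasure_cubeMeasure (d : ℕ) : IsProbabilityMeasure (cubeMeasure d) := by
  have : IsProbabilityMeasure (volume.restrict (Set.Ico (0 : ℝ) 1)) := ⟨by simp⟩
  unfold cubeMeasure
  infer_instance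

/-- The vector `(ψ_𝐤(x))_𝐤` of `ℓ₂(ℤ^d)`, which represents evaluation at `x`. -/
noncomputable def psiVec {lam : ℕ → ℝ} (h : HasSum (fun k => lam k ^ 2) 1) {d : ℕ}
    (x : Fin d → ℝ) : lp (fun _ : Fin d → ℤ => ℝ) 2 :=
  ⟨fun k => psiProd lam k x, memℓp_gen (by simpa using (hasSum_psiProd_sq h x).summable)⟩

section psiVec

variable {lam : ℕ → ℝ} (h : HasSum (fun k => lam k ^ 2) 1) {d : ℕ}

lemma hasSum_inner_psiVec (c : lp (fun _ : Fin d → ℤ => ℝ) 2) (x : Fin d → ℝ) :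
    HasSum (fun k => c k * psiProd lam k x) ⟪psiVec h x, c⟫_ℝ := by
  exact lp.hasSum_inner (𝕜 := ℝ) (psiVec h x) c

lemma norm_psiVec (x : Fin d → ℝ) : ‖psiVec h x‖ = 1 := by
  have h1 := hasSum_inner_psiVec h (psiVec h x) x
  have h2 := h1.unique (by simpa [psiVec, sq] using hasSum_psiProd_sq h x)
  rw [real_inner_self_eq_norm_sq] at h2
  exact (pow_eq_one_iff_of_nonneg (norm_nonneg _) two_ne_zero).1 h2

lemma measurable_inner_psiVec (c : lp (fun _ : Fin d → ℤ => ℝ) 2) :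
    Measurable fun x => ⟪psiVec h x, c⟫_ℝ := by
  refine measurable_of_tendsto_metrizable' Filter.atTop
    (f := fun (s : Finset (Fin d → ℤ)) x => ∑ k ∈ s, c k * psiProd lam k x) (fun s => ?_)
    (tendsto_pi_nhds.2 fun x => hasSum_inner_psiVec h c x)
  exact (continuous_finsetSum _ fun k _ =>
    continuous_const.mul (continuous_psiProd lam k)).measurable

lemma sum_sq_le_norm_sq (c : lp (fun _ : Fin d → ℤ => ℝ) 2) (s : Finset (Fin d → ℤ)) :
    ∑ k ∈ s, c k ^ 2 ≤ ‖c‖ ^ 2 := by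
  have := lp.hasSum_inner (𝕜 := ℝ) c c
  rw [real_inner_self_eq_norm_sq] at this
  simp only [real_inner_self_eq_norm_sq, Real.norm_eq_abs, sq_abs] at this
  exact sum_le_hasSum s (fun _ _ => sq_nonneg _) this

include h in
lemma sq_sum_le_norm_sq (c : lp (fun _ : Fin d → ℤ => ℝ) 2) (s : Finset (Fin d → ℤ))
    (x : Fin d → ℝ) : (∑ k ∈ s, c k * psiProd lam k x) ^ 2 ≤ ‖c‖ ^ 2 := by
  refine (Finset.sum_mul_sq_le_sq_mul_sq s _ _).trans ?_
  rw [← mul_one (‖c‖ ^ 2)]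
  exact mul_le_mul (sum_sq_le_norm_sq c s)
    (sum_le_hasSum s (fun _ _ => sq_nonneg _) (hasSum_psiProd_sq h x))
    (Finset.sum_nonneg fun _ _ => sq_nonneg _) (sq_nonneg _)

include h in
lemma integrable_psiProd_mul_psiProd (k m : Fin d → ℤ) :
    Integrable (fun x => psiProd lam k x * psiProd lam m x) (cubeMeasure d) := by
  refine Integrable.of_bound ((continuous_psiProd lam k).mul
    (continuous_psiProd lam m)).aestronglyMeasurable 1 (Filter.Eventually.of_forall fun x => ?_)
  rw [norm_mul, Real.norm_eq_abs, Real.norm_eq_abs]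
  exact mul_le_one₀ ((sq_le_one_iff_abs_le_one _).1 (sq_psiProd_le_one h k x)) (abs_nonneg _)
    ((sq_le_one_iff_abs_le_one _).1 (sq_psiProd_le_one h m x))

include h in
lemma integral_sq_sum_le {β : ℝ} (hβ0 : lam 0 ^ 2 ≤ β) (hβ : ∀ k : ℕ, lam (k + 1) ^ 2 / 2 ≤ β)
    (c : lp (fun _ : Fin d → ℤ => ℝ) 2) (s : Finset (Fin d → ℤ)) :
    ∫ x, (∑ k ∈ s, c k * psiProd lam k x) ^ 2 ∂cubeMeasure d ≤ β ^ d * ‖c‖ ^ 2 := by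
  have hi := integrable_psiProd_mul_psiProd h (d := d)
  have hexp : ∀ x, (∑ k ∈ s, c k * psiProd lam k x) ^ 2 =
      ∑ k ∈ s, ∑ m ∈ s, c k * c m * (psiProd lam k x * psiProd lam m x) := by
    intro x
    rw [sq, Finset.sum_mul_sum]
    exact Finset.sum_congr rfl fun k _ => Finset.sum_congr rfl fun m _ => by ring
  simp_rw [hexp]
  rw [integral_finsetSum _ fun k _ => integrable_finsetSum _ fun m _ => (hi k m).const_mul _]
  refine le_trans ?_ (mul_le_mul_of_nonneg_left (sum_sq_le_norm_sq c s)
    (pow_nonneg ((sq_nonneg _).trans hβ0) d))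
  rw [Finset.mul_sum]
  refine Finset.sum_le_sum fun k hk => ?_
  rw [integral_finsetSum _ fun m _ => (hi k m).const_mul _]
  simp_rw [integral_const_mul, integral_psiProd_mul_psiProd]
  simp only [mul_ite, mul_zero, Finset.sum_ite_eq, hk, if_true]
  rw [mul_comm, ← sq]
  refine mul_le_mul_of_nonneg_right ?_ (sq_nonneg _)
  calc ∏ j, (if k j = 0 then lam 0 ^ 2 else lam (k j).natAbs ^ 2 / 2)
      ≤ ∏ _j : Fin d, β := by
        refine Finset.prod_le_prod (fun j _ => by split_ifs <;> positivity) fun j _ => ?_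
        split_ifs with hj
        · exact hβ0
        · obtain ⟨a, ha⟩ := Nat.exists_eq_succ_of_ne_zero (Int.natAbs_ne_zero.2 hj)
          rw [ha]
          exact hβ a
    _ = β ^ d := by simp

lemma integrable_sq_inner_psiVec (c : lp (fun _ : Fin d → ℤ => ℝ) 2) :
    Integrable (fun x => ⟪psiVec h x, c⟫_ℝ ^ 2) (cubeMeasure d) := by
  refine Integrable.of_bound ((measurable_inner_psiVec h c).pow_const 2).aestronglyMeasurable
    (‖c‖ ^ 2) (Filter.Eventually.of_forall fun x => ?_)
  rw [norm_pow]
  refine pow_le_pow_left₀ (norm_nonneg _) ?_ 2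
  simpa [norm_psiVec] using norm_inner_le_norm (𝕜 := ℝ) (psiVec h x) c

lemma integral_sq_inner_psiVec_le {β : ℝ} (hβ0 : lam 0 ^ 2 ≤ β)
    (hβ : ∀ k : ℕ, lam (k + 1) ^ 2 / 2 ≤ β) (c : lp (fun _ : Fin d → ℤ => ℝ) 2) :
    ∫ x, ⟪psiVec h x, c⟫_ℝ ^ 2 ∂cubeMeasure d ≤ β ^ d * ‖c‖ ^ 2 := by
  refine le_of_tendsto (tendsto_integral_filter_of_dominated_convergence (l := Filter.atTop)
    (F := fun (s : Finset (Fin d → ℤ)) x => (∑ k ∈ s, c k * psiProd lam k x) ^ 2)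
    (fun _ => ‖c‖ ^ 2) (Filter.Eventually.of_forall fun s => ?_)
    (Filter.Eventually.of_forall fun s => Filter.Eventually.of_forall fun x => ?_)
    (integrable_const _)
    (Filter.Eventually.of_forall fun x => (hasSum_inner_psiVec h c x).pow 2))
    (Filter.Eventually.of_forall fun s => integral_sq_sum_le h hβ0 hβ c s)
  · exact ((continuous_finsetSum _ fun k _ =>
      continuous_const.mul (continuous_psiProd lam k)).pow 2).aestronglyMeasurable
  · rw [Real.norm_of_nonneg (sq_nonneg _)]
    exact sq_sum_le_norm_sq h c s x

end psiVec

lemma separableSpace_lp_two (ι : Type*) [Countable ι] :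
    TopologicalSpace.SeparableSpace (lp (fun _ : ι => ℝ) 2) := by
  classical
  rw [← TopologicalSpace.isSeparable_univ_iff]
  refine ((Set.countable_range fun i : ι =>
    (lp.single 2 i (1 : ℝ) : lp (fun _ : ι => ℝ) 2)).isSeparable.span (R := ℝ)).closure.mono ?_
  intro c _
  refine mem_closure_of_tendsto (lp.hasSum_single (p := 2) ENNReal.ofNat_ne_top c)
    (Filter.Eventually.of_forall fun s => Submodule.sum_mem _ fun i _ => ?_)
  have : (lp.single 2 i (c i) : lp (fun _ : ι => ℝ) 2) = c i • lp.single 2 i (1 : ℝ) := by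
    rw [← lp.single_smul]
    simp
  rw [this]
  exact Submodule.smul_mem _ _ (Submodule.subset_span ⟨i, rfl⟩)

/-- If every element of the unit ball annihilated by the information has uniform norm at most `E`,
then the projection of `psiVec` to the kernel of the information has norm at most `E`. -/
lemma ae_one_sub_norm_sq_le {lam : ℕ → ℝ} (h : HasSum (fun k => lam k ^ 2) 1) {d : ℕ}
    (W : Submodule ℝ (lp (fun _ : Fin d → ℤ => ℝ) 2)) [W.HasOrthogonalProjection] {E : ℝ}
    (hE : ∀ c ∈ Wᗮ, ‖c‖ ≤ 1 → ∀ᵐ x ∂cubeMeasure d, |⟪psiVec h x, c⟫_ℝ| ≤ E) :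
    ∀ᵐ x ∂cubeMeasure d, 1 - ‖W.orthogonalProjectionOnto (psiVec h x)‖ ^ 2 ≤ E ^ 2 := by
  have := separableSpace_lp_two (Fin d → ℤ)
  have : SecondCountableTopology (lp (fun _ : Fin d → ℤ => ℝ) 2) :=
    UniformSpace.secondCountable_of_separable _
  have hseq : ∀ᵐ x ∂cubeMeasure d, ∀ m,
      |⟪psiVec h x, (TopologicalSpace.denseSeq Wᗮ m : Wᗮ)⟫_ℝ| ≤
        E * ‖TopologicalSpace.denseSeq Wᗮ m‖ := by
    rw [ae_all_iff]
    intro m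
    set u := TopologicalSpace.denseSeq Wᗮ m
    have hn : ‖(‖u‖⁻¹ • (u : lp (fun _ : Fin d → ℤ => ℝ) 2))‖ ≤ 1 := by
      rw [norm_smul, norm_inv, norm_norm, Submodule.norm_coe]
      exact inv_mul_le_one
    filter_upwards [hE _ (Wᗮ.smul_mem ‖u‖⁻¹ u.2) hn] with x hx
    rcases eq_or_ne u 0 with hu | hu
    · simp [hu]
    · have hpos : 0 < ‖u‖ := norm_pos_iff.2 hu
      rw [real_inner_smul_right, abs_mul, abs_inv, abs_norm, inv_mul_le_iff₀ hpos] at hx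
      linarith
  filter_upwards [hseq] with x hx
  have hall : ∀ v : Wᗮ, |⟪psiVec h x, (v : lp (fun _ : Fin d → ℤ => ℝ) 2)⟫_ℝ| ≤ E * ‖v‖ := by
    have hclosed : IsClosed {v : Wᗮ |
        |⟪psiVec h x, (v : lp (fun _ : Fin d → ℤ => ℝ) 2)⟫_ℝ| ≤ E * ‖v‖} :=
      isClosed_le (by fun_prop) (by fun_prop)
    intro v
    exact (hclosed.closure_subset_iff.2 (Set.range_subset_iff.2 hx))
      (TopologicalSpace.denseRange_denseSeq Wᗮ v)
  set p := W.orthogonalProjectionOnto (psiVec h x) with hp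
  set v : lp (fun _ : Fin d → ℤ => ℝ) 2 := psiVec h x - p with hv
  have hvW : v ∈ Wᗮ := W.sub_starProjection_mem_orthogonal _
  have hpv : ⟪(p : lp (fun _ : Fin d → ℤ => ℝ) 2), v⟫_ℝ = 0 := hvW _ p.2
  have hdec : psiVec h x = p + v := by rw [hv]; abel
  have h1 := hall ⟨v, hvW⟩
  have h2 : ‖psiVec h x‖ ^ 2 = ‖p‖ ^ 2 + ‖v‖ ^ 2 := by
    rw [hdec, norm_add_sq_real, hpv, Submodule.norm_coe]
    ring
  have h3 : ⟪psiVec h x, v⟫_ℝ = ‖v‖ ^ 2 := by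
    rw [hdec, inner_add_left, hpv, real_inner_self_eq_norm_sq, zero_add]
  rw [norm_psiVec] at h2
  simp only [h3, Submodule.coe_norm, abs_of_nonneg (sq_nonneg ‖v‖)] at h1
  nlinarith [sq_nonneg (E - ‖v‖)]

lemma one_sub_mul_pow_le_sq {lam : ℕ → ℝ} (h : HasSum (fun k => lam k ^ 2) 1) {β : ℝ}
    (hβ0 : lam 0 ^ 2 ≤ β) (hβ : ∀ k : ℕ, lam (k + 1) ^ 2 / 2 ≤ β) {d n : ℕ}
    (L : Fin n → lp (fun _ : Fin d → ℤ => ℝ) 2 →L[ℝ] ℝ)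
    (φ : (Fin n → ℝ) → (Fin d → ℝ) → ℝ) {E : ℝ} (hE0 : 0 ≤ E)
    (hE : ∀ c : lp (fun _ : Fin d → ℤ => ℝ) 2, ‖c‖ ≤ 1 →
      essSup (fun x => ENNReal.ofReal
          |(∑' k : Fin d → ℤ, c k * psiProd lam k x) - φ (fun i => L i c) x|)
        (cubeMeasure d) ≤ ENNReal.ofReal E) :
    1 - n * β ^ d ≤ E ^ 2 := by
  have hae : ∀ c : lp (fun _ : Fin d → ℤ => ℝ) 2, ‖c‖ ≤ 1 →
      ∀ᵐ x ∂cubeMeasure d, |⟪psiVec h x, c⟫_ℝ - φ (fun i => L i c) x| ≤ E := by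
    intro c hc
    filter_upwards [ENNReal.ae_le_essSup (μ := cubeMeasure d) fun x => ENNReal.ofReal
      |(∑' k : Fin d → ℤ, c k * psiProd lam k x) - φ (fun i => L i c) x|] with x hx
    rw [← (hasSum_inner_psiVec h c x).tsum_eq]
    exact (ENNReal.ofReal_le_ofReal_iff hE0).1 (hx.trans (hE c hc))
  set w : Fin n → lp (fun _ : Fin d → ℤ => ℝ) 2 :=
    fun i => (InnerProductSpace.toDual ℝ _).symm (L i) with hw
  set W := Submodule.span ℝ (Set.range w)
  have hker : ∀ c ∈ Wᗮ, ∀ i, L i c = 0 := by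
    intro c hc i
    have := hc (w i) (Submodule.subset_span ⟨i, rfl⟩)
    rwa [hw, InnerProductSpace.toDual_symm_apply] at this
  have : FiniteDimensional ℝ W := FiniteDimensional.span_of_finite ℝ (Set.finite_range w)
  have hkey := ae_one_sub_norm_sq_le h W (E := E) fun c hc hc1 => by
    filter_upwards [hae c hc1, hae (-c) (by rwa [norm_neg])] with x h1 h2
    have h3 : (fun i => L i (-c)) = fun i => L i c := by
      ext i
      rw [hker c hc i, hker _ (Wᗮ.neg_mem hc) i]
    rw [h3, inner_neg_right] at h2
    rw [abs_le] at h1 h2 ⊢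
    constructor <;> linarith
  set b := stdOrthonormalBasis ℝ W
  have hb : ∀ x : Fin d → ℝ, ‖W.orthogonalProjectionOnto (psiVec h x)‖ ^ 2 =
      ∑ i, ⟪psiVec h x, (b i : lp (fun _ : Fin d → ℤ => ℝ) 2)⟫_ℝ ^ 2 := by
    intro x
    rw [← b.sum_sq_norm_inner_left]
    refine Finset.sum_congr rfl fun i _ => ?_
    rw [Submodule.inner_orthogonalProjectionOnto_eq_of_mem_right, Real.norm_eq_abs, sq_abs]
  simp_rw [hb] at hkey
  have hint : ∀ i ∈ Finset.univ, Integrable (fun x =>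
      ⟪psiVec h x, (b i : lp (fun _ : Fin d → ℤ => ℝ) 2)⟫_ℝ ^ 2) (cubeMeasure d) :=
    fun i _ => integrable_sq_inner_psiVec h _
  have hle := integral_mono_ae ((integrable_const 1).sub (integrable_finsetSum _ hint))
    (integrable_const (E ^ 2)) hkey
  rw [integral_sub' (integrable_const 1) (integrable_finsetSum _ hint),
    integral_finsetSum _ hint] at hle
  simp only [integral_const, probReal_univ, smul_eq_mul, one_mul] at hle
  have hβd : 0 ≤ β ^ d := pow_nonneg ((sq_nonneg _).trans hβ0) d
  have hsum : ∑ i, ∫ x, ⟪psiVec h x, (b i : lp (fun _ : Fin d → ℤ => ℝ) 2)⟫_ℝ ^ 2 ∂cubeMeasure d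
      ≤ n * β ^ d := by
    calc _ ≤ ∑ _i : Fin (Module.finrank ℝ W), β ^ d := by
          refine Finset.sum_le_sum fun i _ => ?_
          refine (integral_sq_inner_psiVec_le h hβ0 hβ _).trans_eq ?_
          rw [Submodule.norm_coe, b.norm_eq_one]
          ring
      _ = Module.finrank ℝ W * β ^ d := by simp
      _ ≤ n * β ^ d := by
          refine mul_le_mul_of_nonneg_right ?_ hβd
          have := finrank_range_le_card (R := ℝ) w
          rw [Fintype.card_fin] at this
          exact_mod_cast this
  linarith

/-- Curse of dimensionality for deterministic uniform
approximation on the unweighted tensor-product space `H_λ(𝕋^d)`: with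
`β = max(λ₀², sup_{k≥1} λ_k²/2) ∈ (0,1)`, any deterministic method using `n`
continuous linear functionals has worst-case error at least
`√(max(1 − n β^d, 0))`; in particular error `≤ ε` forces `n ≥ β^{-d}(1−ε)²`. -/
theorem stmt8
    (lam : ℕ → ℝ) (hpos : ∀ k, 0 ≤ lam k) (h0 : lam 0 < 1)
    (hsummable : Summable fun k => lam k ^ 2) (hsum : ∑' k, lam k ^ 2 = 1)
    (β : ℝ) (hβ : β = max (lam 0 ^ 2) (⨆ k : ℕ, lam (k + 1) ^ 2 / 2))
    (d : ℕ) (hd : 1 ≤ d)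
    (n : ℕ) (L : Fin n → lp (fun _ : Fin d → ℤ => ℝ) 2 →L[ℝ] ℝ)
    (φ : (Fin n → ℝ) → (Fin d → ℝ) → ℝ) :
    (ENNReal.ofReal (Real.sqrt (max (1 - n * β ^ d) 0))
      ≤ ⨆ (c : lp (fun _ : Fin d → ℤ => ℝ) 2) (_ : ‖c‖ ≤ 1),
          essSup (fun x => ENNReal.ofReal
              |(∑' k : Fin d → ℤ, c k * psiProd lam k x) - φ (fun i => L i c) x|)
            (cubeMeasure d))
    ∧ ∀ ε : ℝ, ε ∈ Set.Ioo (0 : ℝ) 1 →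
        (∀ c : lp (fun _ : Fin d → ℤ => ℝ) 2, ‖c‖ ≤ 1 →
          essSup (fun x => ENNReal.ofReal
              |(∑' k : Fin d → ℤ, c k * psiProd lam k x) - φ (fun i => L i c) x|)
            (cubeMeasure d) ≤ ENNReal.ofReal ε) →
        β ^ (-(d : ℤ)) * (1 - ε) ^ 2 ≤ (n : ℝ) := by
  have h : HasSum (fun k => lam k ^ 2) 1 := hsum ▸ hsummable.hasSum
  have hβ0 : lam 0 ^ 2 ≤ β := hβ ▸ le_max_left _ _
  have hbdd : BddAbove (Set.range fun k : ℕ => lam (k + 1) ^ 2 / 2) := by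
    refine ⟨1, ?_⟩
    rintro _ ⟨k, rfl⟩
    have := le_hasSum h (k + 1) fun _ _ => sq_nonneg _
    dsimp only
    linarith
  have hβ1 : ∀ k : ℕ, lam (k + 1) ^ 2 / 2 ≤ β := fun k =>
    hβ ▸ (le_ciSup hbdd k).trans (le_max_right _ _)
  constructor
  · set S := ⨆ (c : lp (fun _ : Fin d → ℤ => ℝ) 2) (_ : ‖c‖ ≤ 1),
      essSup (fun x => ENNReal.ofReal
          |(∑' k : Fin d → ℤ, c k * psiProd lam k x) - φ (fun i => L i c) x|)
        (cubeMeasure d) with hS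
    rcases eq_or_ne S ⊤ with hT | hT
    · rw [hT]
      exact le_top
    · have key := one_sub_mul_pow_le_sq h hβ0 hβ1 L φ (E := S.toReal) ENNReal.toReal_nonneg
        fun c hc => by
          rw [ENNReal.ofReal_toReal hT]
          exact le_iSup₂_of_le c hc le_rfl
      refine ENNReal.ofReal_le_of_le_toReal ?_
      rw [Real.sqrt_le_left ENNReal.toReal_nonneg]
      exact max_le key (sq_nonneg _)
  · rintro ε ⟨hε0, hε1⟩ hE
    have key := one_sub_mul_pow_le_sq h hβ0 hβ1 L φ hε0.le hE
    rw [zpow_neg, zpow_natCast]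
    rcases (pow_nonneg ((sq_nonneg _).trans hβ0) d).eq_or_lt with h0 | hpos
    · rw [← h0]
      simp
    · rw [inv_mul_le_iff₀ hpos]
      nlinarith
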